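/- Let n ∈ ℕ, let K be a singular, strictly concave and strictly monotone (SM) kernel function, let J be an upper semicontinuous n-field function, and let r₁,…,rₙ > 0. Then the function m̄ attains its infimum over S̄, i.e., there exists w ∈ S̄ with m̄(w) = inf_{x ∈ S̄} m̄(x). Moreover, every such minimum point w is an equioscillation point, i.e., m₀(w) = m₁(w) = ⋯ = mₙ(w), and every such w belongs to the regularity set Y, in particular to the open simplex S. -/

import Mathlib

open Set Filter

noncomputable section

/-- A kernel function: `ℝ ∪ {−∞}`-valued (modeled as `EReal`, never `⊤`),
finite and concave on `(-1,0)` and `(0,1)`, extended continuously to `[-1,1]`. -/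
structure IsKernel (K : ℝ → EReal) : Prop where
  ne_top : ∀ t, K t ≠ ⊤
  finite_off_zero : ∀ t ∈ Ioo (-1:ℝ) 1, t ≠ 0 → K t ≠ ⊥
  concave_neg : ConcaveOn ℝ (Ioo (-1:ℝ) 0) (fun t => (K t).toReal)
  concave_pos : ConcaveOn ℝ (Ioo (0:ℝ) 1) (fun t => (K t).toReal)
  lim_zero_left : Tendsto K (nhdsWithin 0 (Iio 0)) (nhds (K 0))
  lim_zero_right : Tendsto K (nhdsWithin 0 (Ioi 0)) (nhds (K 0))
  lim_neg_one : Tendsto K (nhdsWithin (-1) (Ioi (-1))) (nhds (K (-1)))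
  lim_one : Tendsto K (nhdsWithin 1 (Iio 1)) (nhds (K 1))

/-- Singularity condition `(∞)`: `K(0) = −∞`. -/
def SingularKernel (K : ℝ → EReal) : Prop := K 0 = ⊥

/-- Monotonicity condition (M). -/
def MonotoneKernel (K : ℝ → EReal) : Prop :=
  AntitoneOn K (Ioo (-1:ℝ) 0) ∧ MonotoneOn K (Ioo (0:ℝ) 1)

/-- Strict monotonicity condition (SM). -/
def StrictMonotoneKernel (K : ℝ → EReal) : Prop :=
  StrictAntiOn K (Ico (-1:ℝ) 0) ∧ StrictMonoOn K (Ioc (0:ℝ) 1)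

/-- Strict concavity of a kernel function. -/
def StrictConcaveKernel (K : ℝ → EReal) : Prop :=
  StrictConcaveOn ℝ (Ioo (-1:ℝ) 0) (fun t => (K t).toReal) ∧
  StrictConcaveOn ℝ (Ioo (0:ℝ) 1) (fun t => (K t).toReal)

/-- An `n`-field function: bounded above, never `+∞`, finite on a set of weighted
cardinality exceeding `n` (interior points of `[0,1]` count `1`, the endpoints `1/2`). -/
def IsFieldFn (n : ℕ) (J : ℝ → EReal) : Prop :=
  (∀ t, J t ≠ ⊤) ∧ (∃ M : ℝ, ∀ t ∈ Icc (0:ℝ) 1, J t ≤ (M : EReal)) ∧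
  ∃ T : Finset ℝ, (T : Set ℝ) ⊆ Icc (0:ℝ) 1 ∧ (∀ t ∈ T, J t ≠ ⊥) ∧
    (n : ℝ) < ∑ t ∈ T, (if t = 0 ∨ t = 1 then (1/2 : ℝ) else 1)

/-- The closed simplex `S̄`. -/
def closedSimplex (n : ℕ) : Set (Fin n → ℝ) :=
  {y | Monotone y ∧ ∀ j, y j ∈ Icc (0:ℝ) 1}

/-- The open simplex `S`. -/
def openSimplex (n : ℕ) : Set (Fin n → ℝ) :=
  {y | StrictMono y ∧ ∀ j, y j ∈ Ioo (0:ℝ) 1}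

/-- Extended nodes: `y₀ = 0`, `y_{n+1} = 1`. -/
def extNode {n : ℕ} (y : Fin n → ℝ) (j : Fin (n + 2)) : ℝ :=
  if _h0 : (j : ℕ) = 0 then 0
  else if _hn : (j : ℕ) ≤ n then y ⟨(j : ℕ) - 1, by omega⟩
  else 1

/-- The interval `I_j(y) = [y_j, y_{j+1}]`, `j = 0, …, n`. -/
def nodeInterval {n : ℕ} (y : Fin n → ℝ) (j : Fin (n + 1)) : Set ℝ :=
  Icc (extNode y j.castSucc) (extNode y j.succ)

/-- The sum of translates function `F(y,t) = J(t) + ∑ⱼ rⱼ K(t - yⱼ)`. -/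
def sumTrans {n : ℕ} (r : Fin n → ℝ) (K J : ℝ → EReal) (y : Fin n → ℝ) (t : ℝ) : EReal :=
  J t + ∑ j, (r j : EReal) * K (t - y j)

/-- The interval maximum `m_j(y) = sup_{t ∈ I_j(y)} F(y,t)`. -/
def mj {n : ℕ} (r : Fin n → ℝ) (K J : ℝ → EReal) (j : Fin (n + 1)) (y : Fin n → ℝ) : EReal :=
  sSup (sumTrans r K J y '' nodeInterval y j)

/-- `m̄(y) = max_j m_j(y)`. -/
def mbar {n : ℕ} (r : Fin n → ℝ) (K J : ℝ → EReal) (y : Fin n → ℝ) : EReal :=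
  ⨆ j, mj r K J j y

/-- `m̲(y) = min_j m_j(y)`. -/
def munder {n : ℕ} (r : Fin n → ℝ) (K J : ℝ → EReal) (y : Fin n → ℝ) : EReal :=
  ⨅ j, mj r K J j y

/-- The regularity set `Y`. -/
def regSet {n : ℕ} (r : Fin n → ℝ) (K J : ℝ → EReal) : Set (Fin n → ℝ) :=
  {y ∈ openSimplex n | ∀ j, mj r K J j y ≠ ⊥}

/-- Equioscillation: all interval maxima agree. -/
def Equioscillation {n : ℕ} (r : Fin n → ℝ) (K J : ℝ → EReal) (y : Fin n → ℝ) : Prop :=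
  ∀ i j : Fin (n + 1), mj r K J i y = mj r K J j y

open Topology

namespace EReal

theorem sum_ne_top {ι : Type*} {s : Finset ι} {f : ι → EReal} (hf : ∀ i ∈ s, f i ≠ ⊤) :
    ∑ i ∈ s, f i ≠ ⊤ :=
  Finset.sum_induction f (· ≠ ⊤) (fun _ _ => add_ne_top) zero_ne_top hf

theorem sum_eq_bot {ι : Type*} {s : Finset ι} {f : ι → EReal} {i : ι} (hi : i ∈ s)
    (hf : f i = ⊥) : ∑ i ∈ s, f i = ⊥ := by
  classical
  rw [← Finset.add_sum_erase s f hi, hf, bot_add]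

theorem coe_sum {ι : Type*} (s : Finset ι) (f : ι → ℝ) :
    ((∑ i ∈ s, f i : ℝ) : EReal) = ∑ i ∈ s, (f i : EReal) :=
  map_sum (⟨⟨Real.toEReal, coe_zero⟩, coe_add⟩ : ℝ →+ EReal) f s

theorem coe_mul_ne_top {a : ℝ} (ha : 0 < a) {x : EReal} (hx : x ≠ ⊤) : (a : EReal) * x ≠ ⊤ := by
  induction x with
  | bot => simp [coe_mul_bot_of_pos ha]
  | coe x => rw [← coe_mul]; exact coe_ne_top _
  | top => exact absurd rfl hx

theorem continuousOn_add_of_ne_top {α : Type*} [TopologicalSpace α] {f g : α → EReal} {s : Set α}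
    (hf : ContinuousOn f s) (hg : ContinuousOn g s) (hf' : ∀ x ∈ s, f x ≠ ⊤)
    (hg' : ∀ x ∈ s, g x ≠ ⊤) : ContinuousOn (fun x => f x + g x) s := fun x hx =>
  Tendsto.comp (continuousAt_add (p := (f x, g x)) (.inl (hf' x hx)) (.inr (hg' x hx))).tendsto
    ((hf x hx).prodMk_nhds (hg x hx))

theorem continuousOn_sum_of_ne_top {α ι : Type*} [TopologicalSpace α] (t : Finset ι)
    {f : ι → α → EReal} {s : Set α} (hf : ∀ i ∈ t, ContinuousOn (f i) s)
    (hf' : ∀ i ∈ t, ∀ x ∈ s, f i x ≠ ⊤) : ContinuousOn (fun x => ∑ i ∈ t, f i x) s := by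
  classical
  induction t using Finset.induction_on with
  | empty => simpa using continuousOn_const
  | insert a t ha ih =>
    simp only [Finset.sum_insert ha]
    refine continuousOn_add_of_ne_top (hf a (by simp))
      (ih (fun i hi => hf i (by simp [hi])) fun i hi => hf' i (by simp [hi]))
      (hf' a (by simp)) fun x hx => sum_ne_top fun i hi => hf' i (by simp [hi]) x hx

end EReal

theorem StrictConcaveOn.slope_anti {s : Set ℝ} {f : ℝ → ℝ} (hf : StrictConcaveOn ℝ s f)
    {x₀ x₁ x₂ x₃ : ℝ} (h₀ : x₀ ∈ s) (h₁ : x₁ ∈ s) (h₂ : x₂ ∈ s) (h₃ : x₃ ∈ s)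
    (h₀₁ : x₀ < x₁) (h₁₂ : x₁ ≤ x₂) (h₂₃ : x₂ < x₃) :
    (f x₃ - f x₂) / (x₃ - x₂) < (f x₁ - f x₀) / (x₁ - x₀) := by
  rcases h₁₂.eq_or_lt with rfl | h₁₂
  · exact hf.slope_anti_adjacent h₀ h₃ h₀₁ h₂₃
  · exact (hf.slope_anti_adjacent h₁ h₃ h₁₂ h₂₃).trans (hf.slope_anti_adjacent h₀ h₂ h₀₁ h₁₂)

theorem StrictConcaveOn.spread_lt {s : Set ℝ} {f : ℝ → ℝ} (hf : StrictConcaveOn ℝ s f)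
    {x y p q ε : ℝ} (hp : 0 < p) (hq : 0 < q) (hε : 0 < ε) (hxy : x ≤ y)
    (hx : x ∈ s) (hy : y ∈ s) (hx' : x - ε / q ∈ s) (hy' : y + ε / p ∈ s) :
    p * f (y + ε / p) + q * f (x - ε / q) < p * f y + q * f x := by
  have h := hf.slope_anti hx' hx hy hy' (by simp; positivity) hxy (by simp; positivity)
  rw [add_sub_cancel_left, sub_sub_cancel] at h
  have h' := mul_lt_mul_of_pos_left h hε
  have e₁ : ε * ((f (y + ε / p) - f y) / (ε / p)) = p * (f (y + ε / p) - f y) := by field_simp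
  have e₂ : ε * ((f x - f (x - ε / q)) / (ε / q)) = q * (f x - f (x - ε / q)) := by field_simp
  rw [e₁, e₂] at h'
  linarith

section Kernel

variable {K : ℝ → EReal}

theorem IsKernel.continuousAt (hK : IsKernel K) {s : Set ℝ} (hs : IsOpen s)
    (hs' : s ⊆ Ioo (-1) 1 \ {0}) (hc : ConcaveOn ℝ s fun t => (K t).toReal) {t : ℝ} (ht : t ∈ s) :
    ContinuousAt K t := by
  have h := ((hc.continuousOn hs).continuousAt (hs.mem_nhds ht))
  refine (continuous_coe_real_ereal.continuousAt.comp h).congr ?_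
  filter_upwards [hs.mem_nhds ht] with x hx
  exact EReal.coe_toReal (hK.ne_top x) (hK.finite_off_zero x (hs' hx).1 (hs' hx).2)

theorem IsKernel.continuousOn (hK : IsKernel K) : ContinuousOn K (Icc (-1) 1) := by
  intro t ht
  rcases ht.1.eq_or_lt with rfl | h1
  · exact (continuousWithinAt_Ioi_iff_Ici.1 hK.lim_neg_one).mono Icc_subset_Ici_self
  rcases ht.2.eq_or_lt with rfl | h2
  · exact (continuousWithinAt_Iio_iff_Iic.1 hK.lim_one).mono Icc_subset_Iic_self
  refine ContinuousAt.continuousWithinAt ?_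
  rcases lt_trichotomy t 0 with h | rfl | h
  · refine hK.continuousAt isOpen_Ioo ?_ hK.concave_neg ⟨h1, h⟩
    exact fun x hx => ⟨⟨hx.1, by linarith [hx.2]⟩, hx.2.ne⟩
  · exact continuousAt_iff_continuous_left'_right'.2 ⟨hK.lim_zero_left, hK.lim_zero_right⟩
  · refine hK.continuousAt isOpen_Ioo ?_ hK.concave_pos ⟨h, h2⟩
    exact fun x hx => ⟨⟨by linarith [hx.1], hx.2⟩, hx.1.ne'⟩

theorem IsKernel.ne_bot (hK : IsKernel K) (hsm : StrictMonotoneKernel K) {t : ℝ}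
    (ht : t ∈ Icc (-1) 1) (h0 : t ≠ 0) : K t ≠ ⊥ := by
  rcases ht.1.eq_or_lt with rfl | h1
  · exact ((bot_le).trans_lt (hsm.1 (show (-1 : ℝ) ∈ Ico (-1) 0 by norm_num)
      (show (-1 / 2 : ℝ) ∈ Ico (-1) 0 by norm_num) (by norm_num))).ne'
  rcases ht.2.eq_or_lt with rfl | h2
  · exact ((bot_le).trans_lt (hsm.2 (show (1 / 2 : ℝ) ∈ Ioc 0 1 by norm_num)
      (show (1 : ℝ) ∈ Ioc 0 1 by norm_num) (by norm_num))).ne'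
  exact hK.finite_off_zero t ⟨h1, h2⟩ h0

theorem IsKernel.coe_toReal (hK : IsKernel K) (hsm : StrictMonotoneKernel K) {t : ℝ}
    (ht : t ∈ Icc (-1) 1) (h0 : t ≠ 0) : ((K t).toReal : EReal) = K t :=
  EReal.coe_toReal (hK.ne_top t) (hK.ne_bot hsm ht h0)

end Kernel

theorem sub_mem_Icc_neg_one_one {s t : ℝ} (hs : s ∈ Icc (0 : ℝ) 1) (ht : t ∈ Icc (0 : ℝ) 1) :
    t - s ∈ Icc (-1 : ℝ) 1 :=
  ⟨by linarith [hs.2, ht.1], by linarith [hs.1, ht.2]⟩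

section SumTrans

variable {n : ℕ} {r : Fin n → ℝ} {K J : ℝ → EReal}

theorem isCompact_closedSimplex (n : ℕ) : IsCompact (closedSimplex n) := by
  have h : closedSimplex n = {y | Monotone y} ∩ Set.pi univ fun _ => Icc (0 : ℝ) 1 := by
    ext y; simp only [closedSimplex, mem_ofPred_eq, mem_inter_iff, mem_univ_pi]
  rw [h]
  refine IsCompact.inter_left (isCompact_univ_pi fun _ => isCompact_Icc) ?_
  simp only [Monotone, ofPred_forall]
  exact isClosed_iInter fun i => isClosed_iInter fun j => isClosed_iInter fun _ =>
    isClosed_le (continuous_apply i) (continuous_apply j)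

theorem closedSimplex_nonempty (n : ℕ) : (closedSimplex n).Nonempty :=
  ⟨fun _ => 0, fun _ _ _ => le_rfl, fun _ => by simp⟩

theorem translates_ne_top (hr : ∀ j, 0 < r j) (hK : IsKernel K) (y : Fin n → ℝ) (t : ℝ) :
    ∑ j, (r j : EReal) * K (t - y j) ≠ ⊤ :=
  EReal.sum_ne_top fun j _ => EReal.coe_mul_ne_top (hr j) (hK.ne_top _)

theorem continuousOn_translates (hr : ∀ j, 0 < r j) (hK : IsKernel K) :
    ContinuousOn (fun p : (Fin n → ℝ) × ℝ => ∑ j, (r j : EReal) * K (p.2 - p.1 j))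
      (closedSimplex n ×ˢ Icc 0 1) := by
  refine EReal.continuousOn_sum_of_ne_top _ (fun j _ => ?_)
    fun j _ _ _ => EReal.coe_mul_ne_top (hr j) (hK.ne_top _)
  have h : ContinuousOn (fun p : (Fin n → ℝ) × ℝ => K (p.2 - p.1 j))
      (closedSimplex n ×ˢ Icc 0 1) := by
    refine hK.continuousOn.comp (by fun_prop) fun p hp => ?_
    exact sub_mem_Icc_neg_one_one (hp.1.2 j) hp.2
  intro p hp
  exact EReal.Tendsto.const_mul (h p hp) (.inl (EReal.coe_ne_bot _)) (.inl (EReal.coe_ne_top _))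

theorem upperSemicontinuousOn_sumTrans (hr : ∀ j, 0 < r j) (hK : IsKernel K)
    (hJ : ∀ t, J t ≠ ⊤) (hJusc : UpperSemicontinuousOn J (Icc 0 1)) :
    UpperSemicontinuousOn (fun p : (Fin n → ℝ) × ℝ => sumTrans r K J p.1 p.2)
      (closedSimplex n ×ˢ Icc 0 1) := by
  refine UpperSemicontinuousOn.add' ?_ (continuousOn_translates hr hK).upperSemicontinuousOn ?_
  · exact hJusc.comp (f := J) continuousOn_snd fun p hp => hp.2
  · exact fun p _ => EReal.continuousAt_add (.inl (hJ _)) (.inr (translates_ne_top hr hK _ _))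

theorem continuousOn_sumTrans_left (hr : ∀ j, 0 < r j) (hK : IsKernel K)
    (hJ : ∀ t, J t ≠ ⊤) {t : ℝ} (ht : t ∈ Icc (0 : ℝ) 1) :
    ContinuousOn (fun y => sumTrans r K J y t) (closedSimplex n) := by
  refine EReal.continuousOn_add_of_ne_top continuousOn_const ?_ (fun _ _ => hJ t)
    fun y _ => translates_ne_top hr hK y t
  exact (continuousOn_translates hr hK).comp (f := fun y => (y, t)) (by fun_prop)
    fun y hy => ⟨hy, ht⟩

theorem sumTrans_eq_bot (hr : ∀ j, 0 < r j) (hsing : SingularKernel K) {y : Fin n → ℝ} {t : ℝ}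
    {j : Fin n} (h : y j = t) : sumTrans r K J y t = ⊥ := by
  have h' : (r j : EReal) * K (t - y j) = ⊥ := by
    rw [h, sub_self, hsing, EReal.coe_mul_bot_of_pos (hr j)]
  rw [sumTrans, EReal.sum_eq_bot (Finset.mem_univ j) h', EReal.add_bot]

theorem translates_eq_coe (hK : IsKernel K) (hsm : StrictMonotoneKernel K) {y : Fin n → ℝ}
    (hy : y ∈ closedSimplex n) {t : ℝ} (ht : t ∈ Icc (0 : ℝ) 1) (h : ∀ j, y j ≠ t) :
    ∑ j, (r j : EReal) * K (t - y j) = ((∑ j, r j * (K (t - y j)).toReal : ℝ) : EReal) := by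
  rw [EReal.coe_sum]
  refine Finset.sum_congr rfl fun j _ => ?_
  rw [EReal.coe_mul, hK.coe_toReal hsm (sub_mem_Icc_neg_one_one (hy.2 j) ht)
    (sub_ne_zero.2 (h j).symm)]

theorem sumTrans_ne_bot (hK : IsKernel K) (hsm : StrictMonotoneKernel K) {y : Fin n → ℝ}
    (hy : y ∈ closedSimplex n) {t : ℝ} (ht : t ∈ Icc (0 : ℝ) 1) (h : ∀ j, y j ≠ t)
    (hJt : J t ≠ ⊥) : sumTrans r K J y t ≠ ⊥ := by
  rw [sumTrans, translates_eq_coe hK hsm hy ht h]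
  simp [EReal.add_eq_bot_iff, hJt]

/-- Comparison of two sums of translates at a point which is not an abandoned node. -/
theorem sumTrans_lt_of_translates_lt (hr : ∀ j, 0 < r j) (hK : IsKernel K)
    (hsing : SingularKernel K) (hsm : StrictMonotoneKernel K) (hJ : ∀ t, J t ≠ ⊤)
    {y z : Fin n → ℝ} (hy : y ∈ closedSimplex n) (hz : z ∈ closedSimplex n) {t : ℝ}
    (ht : t ∈ Icc (0 : ℝ) 1) {M : EReal} (hM : M ≠ ⊥) (hle : sumTrans r K J y t ≤ M)
    (hyz : ∀ j, y j = t → z j = t)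
    (hlt : (∀ j, y j ≠ t) → (∀ j, z j ≠ t) →
      ∑ j, r j * (K (t - z j)).toReal < ∑ j, r j * (K (t - y j)).toReal) :
    sumTrans r K J z t < M := by
  by_cases hzt : ∃ j, z j = t
  · obtain ⟨j, hj⟩ := hzt
    rw [sumTrans_eq_bot hr hsing hj]
    exact bot_lt_iff_ne_bot.2 hM
  push Not at hzt
  have hyt : ∀ j, y j ≠ t := fun j hj => hzt j (hyz j hj)
  by_cases hJt : J t = ⊥
  · rw [sumTrans, hJt, EReal.bot_add]
    exact bot_lt_iff_ne_bot.2 hM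
  refine lt_of_lt_of_le ?_ hle
  rw [sumTrans, sumTrans, translates_eq_coe hK hsm hy ht hyt, translates_eq_coe hK hsm hz ht hzt]
  lift J t to ℝ using ⟨hJ t, hJt⟩ with a
  exact_mod_cast add_lt_add_right (hlt hyt hzt) a

end SumTrans

section Nodes

variable {n : ℕ} {r : Fin n → ℝ} {K J : ℝ → EReal} {y : Fin n → ℝ}

theorem extNode_castSucc_eq (y : Fin n → ℝ) (i : Fin (n + 1)) :
    ((i : ℕ) = 0 ∧ extNode y i.castSucc = 0) ∨
      ∃ l : Fin n, (l : ℕ) + 1 = i ∧ extNode y i.castSucc = y l := by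
  by_cases h : (i : ℕ) = 0
  · exact .inl ⟨h, by simp [extNode, h]⟩
  · have := i.2
    refine .inr ⟨⟨i - 1, by omega⟩, by simp; omega, ?_⟩
    have h' : (i : ℕ) ≤ n := by omega
    simp only [extNode, Fin.val_castSucc, h, h', dite_true, dite_false]

theorem extNode_succ_eq (y : Fin n → ℝ) (i : Fin (n + 1)) :
    ((i : ℕ) = n ∧ extNode y i.succ = 1) ∨
      ∃ u : Fin n, (u : ℕ) = i ∧ extNode y i.succ = y u := by
  by_cases h : (i : ℕ) = n
  · exact .inl ⟨h, by simp [extNode, h]⟩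
  · have := i.2
    refine .inr ⟨⟨i, by omega⟩, rfl, ?_⟩
    have h' : (i : ℕ) + 1 ≤ n := by omega
    simp [extNode, h']

theorem nodeInterval_subset (hy : y ∈ closedSimplex n) (i : Fin (n + 1)) :
    nodeInterval y i ⊆ Icc 0 1 := by
  refine Icc_subset_Icc ?_ ?_
  · rcases extNode_castSucc_eq y i with ⟨-, h⟩ | ⟨l, -, h⟩ <;> rw [h]
    exact (hy.2 l).1
  · rcases extNode_succ_eq y i with ⟨-, h⟩ | ⟨l, -, h⟩ <;> rw [h]
    exact (hy.2 l).2

theorem exists_mem_nodeInterval (y : Fin n → ℝ) {t : ℝ} (ht : t ∈ Icc (0 : ℝ) 1) :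
    ∃ i, t ∈ nodeInterval y i := by
  classical
  obtain ⟨i, hi, hmax⟩ := Finset.exists_max_image
    (Finset.univ.filter fun i : Fin (n + 1) => extNode y i.castSucc ≤ t) (fun i => (i : ℕ))
    ⟨0, by simp [extNode, ht.1]⟩
  simp only [Finset.mem_filter, Finset.mem_univ, true_and] at hi hmax
  refine ⟨i, hi, ?_⟩
  by_cases h : (i : ℕ) = n
  · rcases extNode_succ_eq y i with ⟨-, h'⟩ | ⟨u, hu, -⟩
    · rw [h']; exact ht.2
    · omega
  · by_contra! hlt
    have := hmax ⟨i + 1, by omega⟩ hlt.le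
    simp at this

theorem mbar_eq (hy : y ∈ closedSimplex n) :
    mbar r K J y = ⨆ t ∈ Icc (0 : ℝ) 1, sumTrans r K J y t := by
  refine le_antisymm (iSup_le fun i => sSup_le ?_) (iSup₂_le fun t ht => ?_)
  · rintro _ ⟨t, ht, rfl⟩
    exact le_iSup₂ (f := fun t (_ : t ∈ Icc (0 : ℝ) 1) => sumTrans r K J y t) t
      (nodeInterval_subset hy i ht)
  · obtain ⟨i, hi⟩ := exists_mem_nodeInterval y ht
    exact (le_sSup (mem_image_of_mem _ hi)).trans (le_iSup (fun i => mj r K J i y) i)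

theorem sumTrans_le_mbar (hy : y ∈ closedSimplex n) {t : ℝ} (ht : t ∈ Icc (0 : ℝ) 1) :
    sumTrans r K J y t ≤ mbar r K J y := by
  rw [mbar_eq hy]
  exact le_iSup₂ (f := fun t (_ : t ∈ Icc (0 : ℝ) 1) => sumTrans r K J y t) t ht

theorem exists_forall_mbar_le (hr : ∀ j, 0 < r j) (hK : IsKernel K) (hJ : ∀ t, J t ≠ ⊤) :
    ∃ w ∈ closedSimplex n, ∀ x ∈ closedSimplex n, mbar r K J w ≤ mbar r K J x := by
  have h : LowerSemicontinuousOn (fun y => ⨆ t ∈ Icc (0 : ℝ) 1, sumTrans r K J y t)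
      (closedSimplex n) :=
    lowerSemicontinuousOn_biSup fun t ht =>
      (continuousOn_sumTrans_left hr hK hJ ht).lowerSemicontinuousOn
  obtain ⟨w, hw, hmin⟩ := h.exists_isMinOn (closedSimplex_nonempty n) (isCompact_closedSimplex n)
  refine ⟨w, hw, fun x hx => ?_⟩
  rw [mbar_eq hw, mbar_eq hx]
  exact hmin hx

theorem mbar_lt (hr : ∀ j, 0 < r j) (hK : IsKernel K) (hJ : ∀ t, J t ≠ ⊤)
    (hJusc : UpperSemicontinuousOn J (Icc 0 1)) (hy : y ∈ closedSimplex n) {M : EReal}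
    (h : ∀ t ∈ Icc (0 : ℝ) 1, sumTrans r K J y t < M) : mbar r K J y < M := by
  have husc : UpperSemicontinuousOn (fun t => sumTrans r K J y t) (Icc 0 1) :=
    (upperSemicontinuousOn_sumTrans hr hK hJ hJusc).comp (g := fun t => (y, t)) (by fun_prop)
      fun t ht => ⟨hy, ht⟩
  obtain ⟨t, ht, hmax⟩ := husc.exists_isMaxOn ⟨0, by simp⟩ isCompact_Icc
  rw [mbar_eq hy]
  exact (iSup₂_le fun s hs => hmax hs).trans_lt (h t ht)

theorem mbar_ne_bot (hK : IsKernel K) (hsm : StrictMonotoneKernel K) (hJ : IsFieldFn n J)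
    (hy : y ∈ closedSimplex n) : mbar r K J y ≠ ⊥ := by
  classical
  obtain ⟨-, -, T, hT, hTJ, hn⟩ := hJ
  have hcard : n < T.card := by
    have : ∑ t ∈ T, (if t = 0 ∨ t = 1 then (1 / 2 : ℝ) else 1) ≤ ∑ t ∈ T, (1 : ℝ) :=
      Finset.sum_le_sum fun t _ => by split_ifs <;> norm_num
    rw [Finset.sum_const, nsmul_eq_mul, mul_one] at this
    exact_mod_cast hn.trans_le this
  obtain ⟨t, htT, ht⟩ : ∃ t ∈ T, t ∉ Finset.univ.image y :=
    Finset.exists_mem_notMem_of_card_lt_card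
      ((Finset.card_image_le.trans (by simp)).trans_lt hcard)
  have hlt := bot_lt_iff_ne_bot.2 (sumTrans_ne_bot (r := r) hK hsm hy (hT htT)
    (fun j hj => ht (by simp [← hj])) (hTJ t htT))
  exact (hlt.trans_le (sumTrans_le_mbar hy (hT htT))).ne'

theorem mj_eq_bot (hr : ∀ j, 0 < r j) (hsing : SingularKernel K) {i : Fin (n + 1)}
    (h : ∀ t ∈ nodeInterval y i, ∃ j, y j = t) : mj r K J i y = ⊥ := by
  refine le_bot_iff.1 (sSup_le ?_)
  rintro _ ⟨t, ht, rfl⟩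
  obtain ⟨j, hj⟩ := h t ht
  exact (sumTrans_eq_bot hr hsing hj).le

theorem mem_openSimplex_of_mj_ne_bot (hr : ∀ j, 0 < r j) (hsing : SingularKernel K)
    (hy : y ∈ closedSimplex n) (h : ∀ i, mj r K J i y ≠ ⊥) : y ∈ openSimplex n := by
  refine ⟨fun i j hij => lt_of_le_of_ne (hy.1 hij.le) fun he => ?_,
    fun j => ⟨lt_of_le_of_ne (hy.2 j).1 fun he => ?_, lt_of_le_of_ne (hy.2 j).2 fun he => ?_⟩⟩
  · refine h ⟨i + 1, by omega⟩ (mj_eq_bot hr hsing fun t ht => ⟨i, ?_⟩)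
    rcases extNode_castSucc_eq y ⟨i + 1, by omega⟩ with ⟨h0, -⟩ | ⟨l, hl, hl'⟩
    · simp at h0
    rcases extNode_succ_eq y ⟨i + 1, by omega⟩ with ⟨h0, -⟩ | ⟨u, hu, hu'⟩
    · simp at h0; omega
    obtain rfl : l = i := by ext; simpa using hl
    rw [nodeInterval, hl', hu'] at ht
    have huj : u ≤ j := by rw [Fin.le_def, hu]; exact hij
    exact le_antisymm ht.1 (ht.2.trans ((hy.1 huj).trans he.ge))
  · have hn : 0 < n := j.pos
    refine h 0 (mj_eq_bot hr hsing fun t ht => ⟨⟨0, hn⟩, ?_⟩)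
    have h0 : y ⟨0, hn⟩ ≤ y j := hy.1 (by simp [Fin.le_def])
    rcases extNode_castSucc_eq y 0 with ⟨-, hl⟩ | ⟨l, hl, -⟩
    swap
    · simp at hl
    rcases extNode_succ_eq y 0 with ⟨hu, -⟩ | ⟨u, hu, hu'⟩
    · simp at hu; omega
    obtain rfl : u = ⟨0, hn⟩ := by ext; simpa using hu
    rw [nodeInterval, hl, hu'] at ht
    exact le_antisymm ((h0.trans he.ge).trans ht.1) ht.2
  · have hn : 0 < n := j.pos
    refine h (Fin.last n) (mj_eq_bot hr hsing fun t ht => ⟨⟨n - 1, by omega⟩, ?_⟩)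
    have h0 : y j ≤ y ⟨n - 1, by omega⟩ := hy.1 (by simp [Fin.le_def]; omega)
    rcases extNode_castSucc_eq y (Fin.last n) with ⟨hl, -⟩ | ⟨l, hl, hl'⟩
    · simp at hl; omega
    rcases extNode_succ_eq y (Fin.last n) with ⟨-, hu⟩ | ⟨u, hu, -⟩
    swap
    · simp at hu; omega
    have hln : l = ⟨n - 1, by omega⟩ := by ext; simp at hl ⊢; omega
    rw [nodeInterval, hl', hu, hln] at ht
    exact le_antisymm ht.1 (ht.2.trans (he.ge.trans h0))

end Nodes

section Perturbation

variable {n : ℕ} {r : Fin n → ℝ} {K J : ℝ → EReal} {y : Fin n → ℝ}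

theorem eventually_add_mul_le_add_mul {a b c d : ℝ} (hab : a ≤ b) (hcd : a = b → c ≤ d) :
    ∀ᶠ s in 𝓝[>] (0 : ℝ), a + s * c ≤ b + s * d := by
  rcases hab.eq_or_lt with h | h
  · filter_upwards [self_mem_nhdsWithin] with s hs
    have := mul_le_mul_of_nonneg_left (hcd h) (le_of_lt hs)
    linarith
  · have h1 : Tendsto (fun s : ℝ => a + s * c) (𝓝[>] 0) (𝓝 a) :=
      tendsto_nhdsWithin_of_tendsto_nhds (Continuous.tendsto' (by fun_prop) _ _ (by simp))
    have h2 : Tendsto (fun s : ℝ => b + s * d) (𝓝[>] 0) (𝓝 b) :=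
      tendsto_nhdsWithin_of_tendsto_nhds (Continuous.tendsto' (by fun_prop) _ _ (by simp))
    exact (h1.eventually_lt h2 h).mono fun _ => le_of_lt

theorem eventually_add_mul_mem_closedSimplex (hy : y ∈ closedSimplex n) {d : Fin n → ℝ}
    (hd : ∀ i j, i ≤ j → y i = y j → d i ≤ d j) (h0 : ∀ i, y i = 0 → 0 ≤ d i)
    (h1 : ∀ i, y i = 1 → d i ≤ 0) :
    ∀ᶠ s in 𝓝[>] (0 : ℝ), (fun i => y i + s * d i) ∈ closedSimplex n := by
  have e1 : ∀ᶠ s in 𝓝[>] (0 : ℝ), ∀ i j, i ≤ j → y i + s * d i ≤ y j + s * d j := by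
    simp only [eventually_all]
    exact fun i j hij => eventually_add_mul_le_add_mul (hy.1 hij) (hd i j hij)
  have e2 : ∀ᶠ s in 𝓝[>] (0 : ℝ), ∀ i, 0 + s * 0 ≤ y i + s * d i :=
    eventually_all.2 fun i => eventually_add_mul_le_add_mul (hy.2 i).1 fun h => h0 i h.symm
  have e3 : ∀ᶠ s in 𝓝[>] (0 : ℝ), ∀ i, y i + s * d i ≤ 1 + s * 0 :=
    eventually_all.2 fun i => eventually_add_mul_le_add_mul (hy.2 i).2 (h1 i)
  filter_upwards [e1, e2, e3] with s hs1 hs2 hs3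
  exact ⟨fun i j => hs1 i j, fun i => ⟨by simpa using hs2 i, by simpa using hs3 i⟩⟩

theorem exists_mbar_lt_of_perturbation (hr : ∀ j, 0 < r j) (hK : IsKernel K)
    (hJ : ∀ t, J t ≠ ⊤) (hJusc : UpperSemicontinuousOn J (Icc 0 1)) (hy : y ∈ closedSimplex n)
    {d : Fin n → ℝ} {A B c : ℝ} {M : EReal} (hA : 0 ≤ A) (hB : B ≤ 1) (hAB : A ≤ B)
    (hmem : ∀ᶠ s in 𝓝[>] (0 : ℝ), (fun i => y i + s * d i) ∈ closedSimplex n)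
    (hlow : ∀ t ∈ Icc A B, sumTrans r K J y t < M)
    (hout : ∀ᶠ s in 𝓝[>] (0 : ℝ), ∀ t ∈ Icc (0 : ℝ) 1, (t < A - s * c ∨ B + s * c < t) →
      sumTrans r K J (fun i => y i + s * d i) t < M) :
    ∃ z ∈ closedSimplex n, mbar r K J z < M := by
  obtain ⟨U, hU, hU'⟩ := upperSemicontinuousOn_iff_preimage_Iio.1
    (upperSemicontinuousOn_sumTrans (r := r) hr hK hJ hJusc) M
  have hsub : {y} ×ˢ Icc A B ⊆ U := by
    rintro ⟨x, t⟩ ⟨hx, ht⟩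
    obtain rfl : x = y := hx
    exact (hU'.subset ⟨⟨hy, hA.trans ht.1, ht.2.trans hB⟩, hlow t ht⟩).2
  obtain ⟨u, v, hu, hv, hyu, hv', huv⟩ :=
    generalized_tube_lemma isCompact_singleton isCompact_Icc hU hsub
  obtain ⟨δ, hδ, hδv⟩ := isCompact_Icc.exists_cthickening_subset_open hv hv'
  have e1 : ∀ᶠ s in 𝓝[>] (0 : ℝ), (fun i => y i + s * d i) ∈ u := by
    have : Tendsto (fun (s : ℝ) i => y i + s * d i) (𝓝[>] 0) (𝓝 y) :=
      tendsto_nhdsWithin_of_tendsto_nhds (Continuous.tendsto' (by fun_prop) _ _ (by simp))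
    exact this (hu.mem_nhds (hyu rfl))
  have e2 : ∀ᶠ s in 𝓝[>] (0 : ℝ), s * c < δ := by
    have : Tendsto (fun s : ℝ => s * c) (𝓝[>] 0) (𝓝 0) :=
      tendsto_nhdsWithin_of_tendsto_nhds (Continuous.tendsto' (by fun_prop) _ _ (by simp))
    exact this.eventually_lt_const hδ
  obtain ⟨s, hs, hsu, hsδ, hsout⟩ := (hmem.and (e1.and (e2.and hout))).exists
  refine ⟨_, hs, mbar_lt hr hK hJ hJusc hs fun t ht => ?_⟩
  by_cases hout' : t < A - s * c ∨ B + s * c < t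
  · exact hsout t ht hout'
  push Not at hout'
  have htv : t ∈ v := by
    refine hδv (Metric.mem_cthickening_of_dist_le t (max A (min t B)) δ _
      ⟨le_max_left _ _, max_le hAB (min_le_right _ _)⟩ ?_)
    rw [Real.dist_eq, abs_le]
    rcases le_total t B with h | h <;> rcases le_total A t with h' | h' <;>
      rcases le_total A B with h'' | h'' <;>
      simp only [*, min_eq_left, min_eq_right, max_eq_left, max_eq_right] <;> constructor <;> linarith
  exact (hU'.superset ⟨⟨hs, ht⟩, @huv (_, t) ⟨hsu, htv⟩⟩).2

theorem exists_last_eq (y : Fin n → ℝ) (i : Fin n) :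
    ∃ u, i ≤ u ∧ y u = y i ∧ ∀ j, u ≤ j → y j = y i → j = u := by
  classical
  obtain ⟨u, hu, hmax⟩ := Finset.exists_max_image
    (Finset.univ.filter fun j => y j = y i) id ⟨i, by simp⟩
  simp only [Finset.mem_filter, Finset.mem_univ, true_and, id] at hu hmax
  exact ⟨u, hmax i rfl, hu, fun j hj hji => le_antisymm (hmax j hji) hj⟩

theorem exists_first_eq (y : Fin n → ℝ) (i : Fin n) :
    ∃ l, l ≤ i ∧ y l = y i ∧ ∀ j, j ≤ l → y j = y i → j = l := by
  classical
  obtain ⟨u, hu, hmax⟩ := Finset.exists_min_image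
    (Finset.univ.filter fun j => y j = y i) id ⟨i, by simp⟩
  simp only [Finset.mem_filter, Finset.mem_univ, true_and, id] at hu hmax
  exact ⟨u, hmax i rfl, hu, fun j hj hji => le_antisymm hj (hmax j hji)⟩

theorem toReal_lt_toReal_of_pos (hK : IsKernel K) (hsm : StrictMonotoneKernel K) {s t : ℝ}
    (hs : 0 < s) (hst : s < t) (ht : t ≤ 1) : (K s).toReal < (K t).toReal := by
  rw [← EReal.coe_lt_coe_iff, hK.coe_toReal hsm ⟨by linarith, by linarith⟩ hs.ne',
    hK.coe_toReal hsm ⟨by linarith, ht⟩ (hs.trans hst).ne']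
  exact hsm.2 ⟨hs, by linarith⟩ ⟨by linarith, ht⟩ hst

theorem toReal_lt_toReal_of_neg (hK : IsKernel K) (hsm : StrictMonotoneKernel K) {s t : ℝ}
    (hs : -1 ≤ s) (hst : s < t) (ht : t < 0) : (K t).toReal < (K s).toReal := by
  rw [← EReal.coe_lt_coe_iff, hK.coe_toReal hsm ⟨by linarith, by linarith⟩ ht.ne,
    hK.coe_toReal hsm ⟨hs, by linarith⟩ (hst.trans ht).ne]
  exact hsm.1 ⟨hs, by linarith⟩ ⟨by linarith, ht⟩ hst

/-- If the sum of translates stays below its maximum to the left of a node, the maximum can be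
lowered by moving that node to the right. -/
theorem exists_mbar_lt_of_initial (hr : ∀ j, 0 < r j) (hK : IsKernel K)
    (hsing : SingularKernel K) (hsm : StrictMonotoneKernel K)
    (hJ : ∀ t, J t ≠ ⊤) (hJusc : UpperSemicontinuousOn J (Icc 0 1)) (hy : y ∈ closedSimplex n)
    (hM : mbar r K J y ≠ ⊥) {u : Fin n} (hu : y u < 1)
    (hlow : ∀ t ∈ Icc 0 (y u), sumTrans r K J y t < mbar r K J y) :
    ∃ z ∈ closedSimplex n, mbar r K J z < mbar r K J y := by
  classical
  obtain ⟨v, -, hv, hlast⟩ := exists_last_eq y u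
  rw [← hv] at hu hlow hlast
  have hmem : ∀ᶠ s in 𝓝[>] (0 : ℝ),
      (fun i => y i + s * (if i = v then 1 else 0)) ∈ closedSimplex n := by
    refine eventually_add_mul_mem_closedSimplex hy (fun i j hij he => ?_) (fun i _ => ?_)
      fun i hi => ?_
    · by_cases h : i = v
      · subst h; simp [hlast j hij he.symm]
      · simp only [h, if_false]; split_ifs <;> norm_num
    · split_ifs <;> norm_num
    · rw [if_neg]; rintro rfl; exact hu.ne hi
  refine exists_mbar_lt_of_perturbation hr hK hJ hJusc hy (c := 1) le_rfl hu.le (hy.2 v).1 hmem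
    hlow ?_
  filter_upwards [hmem, self_mem_nhdsWithin] with s hs (hs0 : 0 < s) t ht hst
  have hst : y v + s < t := by
    rcases hst with h | h
    · linarith [ht.1]
    · linarith
  refine sumTrans_lt_of_translates_lt hr hK hsing hsm hJ hy hs ht hM (sumTrans_le_mbar hy ht)
    (fun j hj => ?_) fun _ _ => ?_
  · rw [if_neg, mul_zero, add_zero, hj]; rintro rfl; linarith
  · refine Finset.sum_lt_sum (fun j _ => ?_) ⟨v, Finset.mem_univ _, ?_⟩
    · by_cases h : j = v
      · subst h
        refine mul_le_mul_of_nonneg_left (le_of_lt ?_) (hr j).le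
        refine toReal_lt_toReal_of_pos hK hsm ?_ ?_ ?_ <;> simp <;> linarith [ht.2, (hy.2 j).1]
      · simp [h]
    · refine mul_lt_mul_of_pos_left ?_ (hr v)
      refine toReal_lt_toReal_of_pos hK hsm ?_ ?_ ?_ <;> simp <;> linarith [ht.2, (hy.2 v).1]

/-- If the sum of translates stays below its maximum to the right of a node, the maximum can be
lowered by moving that node to the left. -/
theorem exists_mbar_lt_of_final (hr : ∀ j, 0 < r j) (hK : IsKernel K)
    (hsing : SingularKernel K) (hsm : StrictMonotoneKernel K)
    (hJ : ∀ t, J t ≠ ⊤) (hJusc : UpperSemicontinuousOn J (Icc 0 1)) (hy : y ∈ closedSimplex n)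
    (hM : mbar r K J y ≠ ⊥) {l : Fin n} (hl : 0 < y l)
    (hlow : ∀ t ∈ Icc (y l) 1, sumTrans r K J y t < mbar r K J y) :
    ∃ z ∈ closedSimplex n, mbar r K J z < mbar r K J y := by
  classical
  obtain ⟨v, -, hv, hfirst⟩ := exists_first_eq y l
  rw [← hv] at hl hlow hfirst
  have hmem : ∀ᶠ s in 𝓝[>] (0 : ℝ),
      (fun i => y i + s * (if i = v then -1 else 0)) ∈ closedSimplex n := by
    refine eventually_add_mul_mem_closedSimplex hy (fun i j hij he => ?_) (fun i hi => ?_)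
      fun i _ => ?_
    · by_cases h : j = v
      · subst h; simp [hfirst i hij he]
      · simp only [h, if_false]; split_ifs <;> norm_num
    · rw [if_neg]; rintro rfl; exact hl.ne' hi
    · split_ifs <;> norm_num
  refine exists_mbar_lt_of_perturbation hr hK hJ hJusc hy (c := 1) hl.le le_rfl (hy.2 v).2 hmem
    hlow ?_
  filter_upwards [hmem, self_mem_nhdsWithin] with s hs (hs0 : 0 < s) t ht hst
  have hst : t < y v - s := by
    rcases hst with h | h
    · linarith
    · linarith [ht.2]
  refine sumTrans_lt_of_translates_lt hr hK hsing hsm hJ hy hs ht hM (sumTrans_le_mbar hy ht)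
    (fun j hj => ?_) fun _ _ => ?_
  · rw [if_neg, mul_zero, add_zero, hj]; rintro rfl; linarith
  · refine Finset.sum_lt_sum (fun j _ => ?_) ⟨v, Finset.mem_univ _, ?_⟩
    · by_cases h : j = v
      · subst h
        refine mul_le_mul_of_nonneg_left (le_of_lt ?_) (hr j).le
        refine toReal_lt_toReal_of_neg hK hsm ?_ ?_ ?_ <;> simp <;> linarith [ht.1, (hy.2 j).2]
      · simp [h]
    · refine mul_lt_mul_of_pos_left ?_ (hr v)
      refine toReal_lt_toReal_of_neg hK hsm ?_ ?_ ?_ <;> simp <;> linarith [ht.1, (hy.2 v).2]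

/-- If the sum of translates stays below its maximum between two nodes, the maximum can be lowered
by spreading these nodes apart at speeds inversely proportional to their multiplicities. -/
theorem exists_mbar_lt_of_inner (hr : ∀ j, 0 < r j) (hK : IsKernel K)
    (hsing : SingularKernel K) (hsc : StrictConcaveKernel K) (hsm : StrictMonotoneKernel K)
    (hJ : ∀ t, J t ≠ ⊤) (hJusc : UpperSemicontinuousOn J (Icc 0 1)) (hy : y ∈ closedSimplex n)
    (hM : mbar r K J y ≠ ⊥) {l u : Fin n} (hlu : l < u) (hl : 0 < y l) (hu : y u < 1)
    (hlow : ∀ t ∈ Icc (y l) (y u), sumTrans r K J y t < mbar r K J y) :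
    ∃ z ∈ closedSimplex n, mbar r K J z < mbar r K J y := by
  classical
  obtain ⟨a, hal, ha, hfirst⟩ := exists_first_eq y l
  obtain ⟨b, hub, hb, hlast⟩ := exists_last_eq y u
  rw [← ha] at hl hlow hfirst
  rw [← hb] at hu hlow hlast
  have hab : a < b := hal.trans_lt (hlu.trans_le hub)
  have hyab : y a ≤ y b := hy.1 hab.le
  have hra := hr a
  have hrb := hr b
  obtain ⟨d, hda, hdb, hd⟩ : ∃ d : Fin n → ℝ, d a = -(1 / r a) ∧ d b = 1 / r b ∧
      ∀ j, j ≠ a → j ≠ b → d j = 0 :=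
    ⟨fun j => if j = a then -(1 / r a) else if j = b then 1 / r b else 0, by simp,
      by simp [hab.ne'], fun j h h' => by simp [h, h']⟩
  have hd1 : ∀ j, j ≠ a → 0 ≤ d j := fun j h => by
    by_cases h' : j = b
    · rw [h', hdb]; positivity
    · rw [hd j h h']
  have hd2 : ∀ j, j ≠ b → d j ≤ 0 := fun j h => by
    by_cases h' : j = a
    · rw [h', hda, neg_nonpos]; positivity
    · rw [hd j h' h]
  have hmem : ∀ᶠ s in 𝓝[>] (0 : ℝ), (fun i => y i + s * d i) ∈ closedSimplex n := by
    refine eventually_add_mul_mem_closedSimplex hy (fun i j hij he => ?_) (fun i hi => hd1 i ?_)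
      fun i hi => hd2 i ?_
    · by_cases hi : i = b
      · subst hi; rw [hlast j hij he.symm]
      by_cases hj : j = a
      · subst hj; rw [hfirst i hij he]
      exact (hd2 i hi).trans (hd1 j hj)
    · rintro rfl; exact hl.ne' hi
    · rintro rfl; exact hu.ne hi
  have e1 : ∀ᶠ s in 𝓝[>] (0 : ℝ), s / r a < y a := by
    have : Tendsto (fun s : ℝ => s / r a) (𝓝[>] 0) (𝓝 0) :=
      tendsto_nhdsWithin_of_tendsto_nhds (Continuous.tendsto' (by fun_prop) _ _ (by simp))
    exact this.eventually_lt_const hl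
  have e2 : ∀ᶠ s in 𝓝[>] (0 : ℝ), s / r b < 1 - y b := by
    have : Tendsto (fun s : ℝ => s / r b) (𝓝[>] 0) (𝓝 0) :=
      tendsto_nhdsWithin_of_tendsto_nhds (Continuous.tendsto' (by fun_prop) _ _ (by simp))
    exact this.eventually_lt_const (by linarith)
  refine exists_mbar_lt_of_perturbation hr hK hJ hJusc hy (c := 1 / r a + 1 / r b) hl.le hu.le hyab
    hmem hlow ?_
  filter_upwards [hmem, e1, e2, self_mem_nhdsWithin] with s hs hsa hsb (hs0 : 0 < s) t ht hst
  have pa : 0 < s / r a := by positivity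
  have pb : 0 < s / r b := by positivity
  have hst : t < y a - s / r a ∨ y b + s / r b < t := by
    have : s * (1 / r a + 1 / r b) = s / r a + s / r b := by ring
    rw [this] at hst
    exact hst.imp (fun h => by linarith) fun h => by linarith
  have hta : y a ≠ t := by rcases hst with h | h <;> intro h' <;> linarith
  have htb : y b ≠ t := by rcases hst with h | h <;> intro h' <;> linarith
  have ea : t - (y a + s * d a) = (t - y a) + s / r a := by rw [hda]; ring
  have eb : t - (y b + s * d b) = (t - y b) - s / r b := by rw [hdb]; ring
  refine sumTrans_lt_of_translates_lt hr hK hsing hsm hJ hy hs ht hM (sumTrans_le_mbar hy ht)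
    (fun j hj => ?_) fun _ _ => ?_
  · rw [hd j (by rintro rfl; exact hta hj) (by rintro rfl; exact htb hj), mul_zero, add_zero, hj]
  have key : r a * (K (t - y a + s / r a)).toReal + r b * (K (t - y b - s / r b)).toReal <
      r a * (K (t - y a)).toReal + r b * (K (t - y b)).toReal := by
    rcases hst with h | h
    · refine hsc.1.spread_lt hra hrb hs0 (by linarith) ?_ ?_ ?_ ?_ <;> constructor <;>
        linarith [ht.1]
    · refine hsc.2.spread_lt hra hrb hs0 (by linarith) ?_ ?_ ?_ ?_ <;> constructor <;>
        linarith [ht.2]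
  rw [← sub_neg, ← Finset.sum_sub_distrib,
    Fintype.sum_eq_add a b hab.ne fun j hj => by simp [hd j hj.1 hj.2], ea, eb]
  linarith

theorem mj_eq_mbar_of_minimal (hr : ∀ j, 0 < r j) (hK : IsKernel K)
    (hsing : SingularKernel K) (hsc : StrictConcaveKernel K) (hsm : StrictMonotoneKernel K)
    (hJ : ∀ t, J t ≠ ⊤) (hJusc : UpperSemicontinuousOn J (Icc 0 1)) (hy : y ∈ closedSimplex n)
    (hM : mbar r K J y ≠ ⊥) (hmin : ∀ z ∈ closedSimplex n, mbar r K J y ≤ mbar r K J z)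
    (i : Fin (n + 1)) : mj r K J i y = mbar r K J y := by
  by_contra hne
  have hlt : mj r K J i y < mbar r K J y :=
    lt_of_le_of_ne (le_iSup (fun i => mj r K J i y) i) hne
  have hlow : ∀ t ∈ nodeInterval y i, sumTrans r K J y t < mbar r K J y := fun t ht =>
    (le_sSup (mem_image_of_mem _ ht)).trans_lt hlt
  suffices ∃ z ∈ closedSimplex n, mbar r K J z < mbar r K J y by
    obtain ⟨z, hz, hzlt⟩ := this
    exact hzlt.not_ge (hmin z hz)
  have hA : extNode y i.castSucc = 0 ∨
      ∃ l : Fin n, (l : ℕ) + 1 = i ∧ extNode y i.castSucc = y l ∧ 0 < y l := by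
    rcases extNode_castSucc_eq y i with ⟨-, h⟩ | ⟨l, hl, h⟩
    · exact .inl h
    · exact (hy.2 l).1.eq_or_lt.imp (fun h' => h.trans h'.symm) fun h' => ⟨l, hl, h, h'⟩
  have hB : extNode y i.succ = 1 ∨
      ∃ u : Fin n, (u : ℕ) = i ∧ extNode y i.succ = y u ∧ y u < 1 := by
    rcases extNode_succ_eq y i with ⟨-, h⟩ | ⟨u, hu, h⟩
    · exact .inl h
    · exact (hy.2 u).2.eq_or_lt.imp (fun h' => h.trans h') fun h' => ⟨u, hu, h, h'⟩
  rw [nodeInterval] at hlow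
  rcases hA with hA | ⟨l, hl, hA, hl0⟩ <;> rcases hB with hB | ⟨u, hu, hB, hu1⟩ <;>
    rw [hA, hB] at hlow
  · exact absurd (mbar_lt hr hK hJ hJusc hy hlow) (lt_irrefl _)
  · exact exists_mbar_lt_of_initial hr hK hsing hsm hJ hJusc hy hM hu1 hlow
  · exact exists_mbar_lt_of_final hr hK hsing hsm hJ hJusc hy hM hl0 hlow
  · exact exists_mbar_lt_of_inner hr hK hsing hsc hsm hJ hJusc hy hM
      (by rw [Fin.lt_def]; omega) hl0 hu1 hlow

end Perturbation

theorem statement7 (n : ℕ) (hn : 0 < n) (r : Fin n → ℝ) (hr : ∀ j, 0 < r j)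
    (K J : ℝ → EReal) (hK : IsKernel K)
    (hsing : SingularKernel K) (hsc : StrictConcaveKernel K) (hsm : StrictMonotoneKernel K)
    (hJ : IsFieldFn n J) (hJusc : UpperSemicontinuousOn J (Icc (0:ℝ) 1)) :
    (∃ w ∈ closedSimplex n, mbar r K J w = ⨅ x ∈ closedSimplex n, mbar r K J x) ∧
    ∀ w ∈ closedSimplex n, mbar r K J w = (⨅ x ∈ closedSimplex n, mbar r K J x) →
      Equioscillation r K J w ∧ w ∈ regSet r K J := by
  obtain ⟨w, hw, hwmin⟩ := exists_forall_mbar_le (n := n) (J := J) hr hK hJ.1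
  refine ⟨⟨w, hw, le_antisymm (le_iInf₂ hwmin) (iInf₂_le w hw)⟩, fun w hw hmin => ?_⟩
  have hM : mbar r K J w ≠ ⊥ := mbar_ne_bot hK hsm hJ hw
  have heq := mj_eq_mbar_of_minimal hr hK hsing hsc hsm hJ.1 hJusc hw hM fun z hz =>
    hmin.le.trans (iInf₂_le z hz)
  have hbot : ∀ j, mj r K J j w ≠ ⊥ := fun j => (heq j).symm ▸ hM
  exact ⟨fun i j => (heq i).trans (heq j).symm,
    mem_openSimplex_of_mj_ne_bot hr hsing hw hbot, hbot⟩
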